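/- arXiv:2508.16737 — 5 statements merged into one kernel-verified Lean document; each statement's English description precedes it below -/
import Mathlib

section
/- Let C be a measurable space, let H be a kernel on C (a measurable assignment x ↦ H(x,·) of nonnegative measures on C), and let g : C → [0,∞] be measurable. For a measurable function h : C → [0,∞] write (Hh)(x) = ∫_C h(y) H(x,dy), and define the iterates H⁰g = g and Hⁿ⁺¹g = H(Hⁿg). Suppose there exists a measurable function v₁ : C → (0,∞) such that (Hv₁)(x) ≤ v₁(x) − g(x) for every x ∈ C. Then Σ_{n=0}^∞ (Hⁿg)(x) ≤ v₁(x) for every x ∈ C. -/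
open MeasureTheory ProbabilityTheory ENNReal

/-- The iterates `H⁰g = g`, `Hⁿ⁺¹g = H(Hⁿg)` of a kernel `H` applied to a
nonnegative measurable function `g`, where `(Hh)(x) = ∫ h(y) H(x,dy)`. -/
noncomputable def kernelIter {C : Type*} [MeasurableSpace C]
    (H : ProbabilityTheory.Kernel C C) (g : C → ℝ≥0∞) : ℕ → C → ℝ≥0∞
  | 0 => g
  | n + 1 => fun x => ∫⁻ y, kernelIter H g n y ∂(H x)

theorem measurable_kernelIter {C : Type*} [MeasurableSpace C] (H : Kernel C C)
    {g : C → ℝ≥0∞} (hg : Measurable g) (n : ℕ) : Measurable (kernelIter H g n) := by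
  induction n with
  | zero => exact hg
  | succ n ih => exact ih.lintegral_kernel

theorem sum_range_succ_kernelIter {C : Type*} [MeasurableSpace C] (H : Kernel C C)
    {g : C → ℝ≥0∞} (hg : Measurable g) (n : ℕ) (x : C) :
    ∑ i ∈ Finset.range (n + 1), kernelIter H g i x =
      (∫⁻ y, ∑ i ∈ Finset.range n, kernelIter H g i y ∂(H x)) + g x := by
  rw [Finset.sum_range_succ', lintegral_finsetSum _ fun i _ => measurable_kernelIter H hg i]
  rfl

theorem sum_range_kernelIter_le {C : Type*} [MeasurableSpace C] (H : Kernel C C)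
    {g v : C → ℝ≥0∞} (hg : Measurable g) (hv : ∀ x, (∫⁻ y, v y ∂(H x)) + g x ≤ v x)
    (n : ℕ) (x : C) : ∑ i ∈ Finset.range n, kernelIter H g i x ≤ v x := by
  induction n generalizing x with
  | zero => simp
  | succ n ih =>
    rw [sum_range_succ_kernelIter H hg]
    exact (add_le_add_left (lintegral_mono ih) _).trans (hv x)

/-- Proposition 1 (finiteness via a Lyapunov-type condition): if there is a
positive finite measurable function `v₁` with `(Hv₁)(x) ≤ v₁(x) − g(x)` for all
`x` (equivalently, `(Hv₁)(x) + g(x) ≤ v₁(x)`), then `Σₙ (Hⁿg)(x) ≤ v₁(x)`. -/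
theorem stmt0 {C : Type*} [MeasurableSpace C] (H : Kernel C C)
    (g : C → ℝ≥0∞) (hg : Measurable g)
    (v₁ : C → ℝ≥0∞) (hv₁_meas : Measurable v₁)
    (hv₁_pos : ∀ x, 0 < v₁ x) (hv₁_fin : ∀ x, v₁ x < ⊤)
    (hLyap : ∀ x, (∫⁻ y, v₁ y ∂(H x)) + g x ≤ v₁ x) :
    ∀ x, ∑' n, kernelIter H g n x ≤ v₁ x := by
  exact fun x => ENNReal.tsum_le_of_sum_range_le (sum_range_kernelIter_le H hg hLyap · x)
end

section
/- Let S be a metrizable topological space with its Borel σ-algebra, η a probability measure on S, and p : S × S → [0,∞) a jointly measurable function with M := sup_{x,y ∈ S} p(x,y) < ∞ and such that y ↦ p(x,y) is continuous for every x ∈ S. Define the Markov kernel P(x,A) = ∫_A p(x,y) η(dy), and let π be a stationary probability measure for P, i.e., π(A) = ∫_S P(x,A) π(dx) for all Borel A ⊆ S. Then π is absolutely continuous with respect to η with density π_d(y) := ∫_S p(x,y) π(dx); moreover π_d(y) ≤ M for all y, and π_d is continuous on S. -/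
open MeasureTheory ProbabilityTheory ENNReal

/-- Proposition 5: if a Markov kernel `P(x,dy) = p(x,y) η(dy)` on a metrizable
space has a transition density `p` that is bounded (by `M`) and continuous in
its second argument, then any stationary distribution `π` for `P` is absolutely
continuous with respect to `η`, with density `π_d(y) = ∫ p(x,y) π(dx)` which is
bounded by `M` and continuous. -/
theorem stmt4 {S : Type*} [TopologicalSpace S] [MeasurableSpace S] [BorelSpace S]
    [TopologicalSpace.MetrizableSpace S]
    (η : Measure S) [IsProbabilityMeasure η]
    (p : S → S → ℝ) (hp_meas : Measurable (Function.uncurry p))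
    (hp_nonneg : ∀ x y, 0 ≤ p x y)
    (M : ℝ) (hM : ∀ x y, p x y ≤ M)
    (hp_cont : ∀ x, Continuous fun y => p x y)
    (π : Measure S) [IsProbabilityMeasure π]
    (hstat : ∀ A : Set S, MeasurableSet A →
      π A = ∫⁻ x, (∫⁻ y in A, ENNReal.ofReal (p x y) ∂η) ∂π) :
    (∀ A : Set S, MeasurableSet A →
        π A = ∫⁻ y in A, ENNReal.ofReal (∫ x, p x y ∂π) ∂η) ∧
    (∀ y, (∫ x, p x y ∂π) ≤ M) ∧
    Continuous (fun y => ∫ x, p x y ∂π) := by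
  have meas_section (y : S) : Measurable fun x => p x y :=
    hp_meas.comp measurable_prodMk_right
  have norm_le (x y : S) : ‖p x y‖ ≤ M := by
    rw [Real.norm_of_nonneg (hp_nonneg x y)]
    exact hM x y
  have integrable_section (y : S) : Integrable (fun x => p x y) π :=
    .of_bound (meas_section y).aestronglyMeasurable M (.of_forall fun x => norm_le x y)
  refine ⟨fun A hA => ?_, fun y => ?_, ?_⟩
  · rw [hstat A hA, lintegral_lintegral_swap hp_meas.ennreal_ofReal.aemeasurable]
    refine lintegral_congr fun y => ?_
    rw [ofReal_integral_eq_lintegral_ofReal (integrable_section y)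
      (.of_forall fun x => hp_nonneg x y)]
  · simpa using integral_mono (integrable_section y) (integrable_const M) fun x => hM x y
  · exact continuous_of_dominated (fun y => (meas_section y).aestronglyMeasurable)
      (fun y => .of_forall fun x => norm_le x y) (integrable_const M) (.of_forall hp_cont)
end

section
/- Let K be a measurable space, ν a probability measure on K, and Q a kernel from K to ℝ × [0,∞) × K, interpreted as the conditional law of the triple (V,W,Y) given the starting state x. Assume sup_{x∈K} ∫ (|v| + w) Q(x, d(v,w,y)) < ∞. Define r̃(x) = ∫ v Q(x, d(v,w,y)) and the kernel H̃(x,A) = ∫ w·1_A(y) Q(x, d(v,w,y)). Let u* : K → ℝ be bounded and measurable with u*(x) = r̃(x) + (H̃u*)(x) for every x ∈ K. For bounded measurable u : K → ℝ, define ℓ_u(x,(v,w,y)) = u(x) − v − w·u(y). Then the double-sample product risk L(u) := ∫_K ∬ ℓ_u(x,ω) ℓ_u(x,ω′) Q(x,dω) Q(x,dω′) ν(dx) satisfies L(u) = ∫_K ( (u − u*)(x) − (H̃(u − u*))(x) )² ν(dx) = ‖(I − H̃)(u − u*)‖²_{L²(ν)}. In particular L(u*) = 0. -/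
open MeasureTheory ProbabilityTheory ENNReal NNReal

/-- The first coordinate and the weight are integrable when the sum of their absolute values has
finite integral. -/
theorem integrable_reward_and_weight {K : Type*} [MeasurableSpace K]
    {μ : Measure (ℝ × ℝ≥0 × K)}
    (h : (∫⁻ ω, (ENNReal.ofReal |ω.1| + (ω.2.1 : ℝ≥0∞)) ∂μ) < ∞) :
    Integrable (fun ω : ℝ × ℝ≥0 × K => ω.1) μ ∧
      Integrable (fun ω : ℝ × ℝ≥0 × K => (ω.2.1 : ℝ)) μ := by
  refine ⟨⟨by fun_prop, ?_⟩,
    ⟨Measurable.aestronglyMeasurable (by fun_prop), ?_⟩⟩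
  · rw [hasFiniteIntegral_iff_norm]
    exact (lintegral_mono fun ω => le_self_add).trans_lt h
  · rw [hasFiniteIntegral_iff_norm]
    refine (lintegral_mono fun ω => ?_).trans_lt h
    simp

theorem integrable_weight_mul {K : Type*} [MeasurableSpace K] {μ : Measure (ℝ × ℝ≥0 × K)}
    (hw : Integrable (fun ω : ℝ × ℝ≥0 × K => (ω.2.1 : ℝ)) μ)
    {f : K → ℝ} (hf : Measurable f) {c : ℝ} (hc : ∀ y, |f y| ≤ c) :
    Integrable (fun ω : ℝ × ℝ≥0 × K => (ω.2.1 : ℝ) * f ω.2.2) μ :=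
  hw.mul_bdd (c := c) (Measurable.aestronglyMeasurable (by fun_prop))
    (ae_of_all _ fun ω => hc ω.2.2)

/-- The product of two independent copies of the one-step residual of `u` integrates to the square
of the fixed-point residual `(I - H) (u - ustar)` at the current state. -/
theorem integral_residual_mul_residual {K : Type*} [MeasurableSpace K]
    {μ : Measure (ℝ × ℝ≥0 × K)} [IsProbabilityMeasure μ]
    (h : (∫⁻ ω, (ENNReal.ofReal |ω.1| + (ω.2.1 : ℝ≥0∞)) ∂μ) < ∞)
    {ustar u : K → ℝ} (hustar : Measurable ustar) (hu : Measurable u) {bstar b : ℝ}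
    (hbstar : ∀ y, |ustar y| ≤ bstar) (hb : ∀ y, |u y| ≤ b) {x : K}
    (hfix : ustar x = (∫ ω, ω.1 ∂μ) + ∫ ω, (ω.2.1 : ℝ) * ustar ω.2.2 ∂μ) :
    (∫ ω, (∫ ω', (u x - ω.1 - (ω.2.1 : ℝ) * u ω.2.2)
        * (u x - ω'.1 - (ω'.2.1 : ℝ) * u ω'.2.2) ∂μ) ∂μ)
      = ((u x - ustar x) - ∫ ω, (ω.2.1 : ℝ) * (u ω.2.2 - ustar ω.2.2) ∂μ) ^ 2 := by
  obtain ⟨hv, hw⟩ := integrable_reward_and_weight h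
  have hwu := integrable_weight_mul hw hu hb
  have hws := integrable_weight_mul hw hustar hbstar
  have hres : ∫ ω, (u x - ω.1 - (ω.2.1 : ℝ) * u ω.2.2) ∂μ
      = u x - (∫ ω, ω.1 ∂μ) - ∫ ω, (ω.2.1 : ℝ) * u ω.2.2 ∂μ := by
    rw [integral_sub (by fun_prop) hwu, integral_sub (integrable_const _) hv]
    simp
  simp_rw [integral_const_mul, integral_mul_const, hres, mul_sub]
  rw [integral_sub hwu hws, hfix]
  ring

/-- Identity (14) of the paper: the double-sample product risk of the one-step
residual `ℓ_u(x,(v,w,y)) = u(x) − v − w·u(y)` equals the squared fixed-point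
residual `‖(I − H̃)(u − u*)‖²_{L²(ν)}`, where `u*` is the bounded solution of
`u* = r̃ + H̃u*` with `r̃(x) = ∫ v Q(x,d(v,w,y))` and
`(H̃u)(x) = ∫ w·u(y) Q(x,d(v,w,y))`; in particular the risk of `u*` is `0`. -/
theorem stmt7 {K : Type*} [MeasurableSpace K]
    (ν : Measure K) [IsProbabilityMeasure ν]
    (Q : Kernel K (ℝ × ℝ≥0 × K)) [IsMarkovKernel Q]
    (B : ℝ)
    (hB : ∀ x : K,
      (∫⁻ ω : ℝ × ℝ≥0 × K, (ENNReal.ofReal |ω.1| + (ω.2.1 : ℝ≥0∞)) ∂(Q x))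
        ≤ ENNReal.ofReal B)
    (ustar : K → ℝ) (hustar_meas : Measurable ustar)
    (bstar : ℝ) (hbstar : ∀ x, |ustar x| ≤ bstar)
    (hfix : ∀ x : K, ustar x
      = (∫ ω : ℝ × ℝ≥0 × K, ω.1 ∂(Q x))
        + ∫ ω : ℝ × ℝ≥0 × K, (ω.2.1 : ℝ) * ustar ω.2.2 ∂(Q x))
    (u : K → ℝ) (hu_meas : Measurable u) (b : ℝ) (hb : ∀ x, |u x| ≤ b) :
    (∫ x, (∫ ω : ℝ × ℝ≥0 × K, (∫ ω' : ℝ × ℝ≥0 × K,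
          (u x - ω.1 - (ω.2.1 : ℝ) * u ω.2.2)
            * (u x - ω'.1 - (ω'.2.1 : ℝ) * u ω'.2.2) ∂(Q x)) ∂(Q x)) ∂ν)
      = ∫ x, ((u x - ustar x)
          - ∫ ω : ℝ × ℝ≥0 × K, (ω.2.1 : ℝ) * (u ω.2.2 - ustar ω.2.2) ∂(Q x)) ^ 2 ∂ν ∧
    (∫ x, (∫ ω : ℝ × ℝ≥0 × K, (∫ ω' : ℝ × ℝ≥0 × K,
          (ustar x - ω.1 - (ω.2.1 : ℝ) * ustar ω.2.2)
            * (ustar x - ω'.1 - (ω'.2.1 : ℝ) * ustar ω'.2.2) ∂(Q x)) ∂(Q x)) ∂ν)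
      = 0 := by
  have key := fun x => integral_residual_mul_residual
    ((hB x).trans_lt ENNReal.ofReal_lt_top) hustar_meas hu_meas hbstar hb (hfix x)
  have key_star := fun x => integral_residual_mul_residual
    ((hB x).trans_lt ENNReal.ofReal_lt_top) hustar_meas hustar_meas hbstar hbstar (hfix x)
  exact ⟨integral_congr_ae (ae_of_all _ key), by simp [key_star]⟩
end

section
/- Let (E,λ) be a measure space with λ σ-finite, let S and K be disjoint measurable subsets of E, let β : E → ℝ and p : E × E → [0,∞) be measurable, and write A(x,y) = e^{−β(x)} p(x,y). Define the taboo iterates a₀(x,y) = A(x,y) and a_{n+1}(x,y) = ∫_S A(x,z) aₙ(z,y) λ(dz) for x ∈ S, y ∈ K. Suppose there exists a measurable q : S × K → [0,∞) such that ∫_S A(x,z) q(z,y) λ(dz) ≤ q(x,y) − A(x,y) for all x ∈ S and y ∈ K. Then Σ_{n=0}^∞ aₙ(x,y) ≤ q(x,y) for all x ∈ S and y ∈ K. -/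
open MeasureTheory ProbabilityTheory ENNReal

/-- The taboo iterates `a₀(x,y) = A(x,y)`,
`a_{n+1}(x,y) = ∫_S A(x,z) aₙ(z,y) λ(dz)` of a discounted transition density
`A`, with intermediate steps constrained to `S`. -/
noncomputable def tabooIter {E : Type*} [MeasurableSpace E] (lam : Measure E)
    (S : Set E) (A : E → E → ℝ≥0∞) : ℕ → E → E → ℝ≥0∞
  | 0 => A
  | n + 1 => fun x y => ∫⁻ z in S, A x z * tabooIter lam S A n z y ∂lam

/-- Each taboo iterate is measurable in its starting point. -/
theorem measurable_tabooIter {E : Type*} [MeasurableSpace E] (lam : Measure E) [SFinite lam]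
    (S : Set E) {A : E → E → ℝ≥0∞} (hA : Measurable (Function.uncurry A)) (y : E) (n : ℕ) :
    Measurable fun x => tabooIter lam S A n x y := by
  induction n with
  | zero => exact hA.of_uncurry_right
  | succ n ih =>
    exact Measurable.lintegral_prod_right' (f := fun w : E × E => A w.1 w.2 * _)
      (hA.mul (ih.comp measurable_snd))

/-- The first-step decomposition of the partial sums of the taboo iterates. -/
theorem sum_range_succ_tabooIter {E : Type*} [MeasurableSpace E] (lam : Measure E) [SFinite lam]
    (S : Set E) {A : E → E → ℝ≥0∞} (hA : Measurable (Function.uncurry A)) (x y : E) (n : ℕ) :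
    ∑ k ∈ Finset.range (n + 1), tabooIter lam S A k x y =
      (∫⁻ z in S, A x z * ∑ k ∈ Finset.range n, tabooIter lam S A k z y ∂lam) + A x y := by
  rw [Finset.sum_range_succ']
  simp only [tabooIter, Finset.mul_sum]
  congr 1
  exact (lintegral_finsetSum _ fun k _ =>
    hA.of_uncurry_left.mul (measurable_tabooIter lam S hA y k)).symm

/-- A nonnegative supersolution of the first-step equation on `S` dominates the sum of the taboo
iterates. -/
theorem tsum_tabooIter_le {E : Type*} [MeasurableSpace E] (lam : Measure E) [SFinite lam]
    {S : Set E} (hS : MeasurableSet S) {A : E → E → ℝ≥0∞} (hA : Measurable (Function.uncurry A))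
    (y : E) {Q : E → ℝ≥0∞}
    (hQ : ∀ x ∈ S, (∫⁻ z in S, A x z * Q z ∂lam) + A x y ≤ Q x) {x : E} (hx : x ∈ S) :
    ∑' n, tabooIter lam S A n x y ≤ Q x := by
  have partial_le (n : ℕ) :
      ∀ x ∈ S, ∑ k ∈ Finset.range n, tabooIter lam S A k x y ≤ Q x := by
    induction n with
    | zero => simp
    | succ n ih =>
      intro x hx
      rw [sum_range_succ_tabooIter lam S hA]
      refine le_trans ?_ (hQ x hx)
      gcongr ?_ + _
      refine setLIntegral_mono' hS fun z hz => ?_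
      gcongr
      exact ih z hz
  exact ENNReal.tsum_le_of_sum_range_le fun n => partial_le n x hx

/-- Lyapunov bound for taboo iterates: if
`∫_S A(x,z) q(z,y) λ(dz) ≤ q(x,y) − A(x,y)` for all `x ∈ S`, `y ∈ K`, where
`A(x,y) = e^{−β(x)} p(x,y)`, then `Σₙ aₙ(x,y) ≤ q(x,y)` on `S × K`. -/
theorem stmt10 {E : Type*} [MeasurableSpace E]
    (lam : Measure E) [SigmaFinite lam]
    (S K : Set E) (hS : MeasurableSet S) (hK : MeasurableSet K)
    (hdisj : Disjoint S K)
    (β : E → ℝ) (hβ : Measurable β)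
    (p : E → E → ℝ) (hp_meas : Measurable (Function.uncurry p))
    (hp_nonneg : ∀ x y, 0 ≤ p x y)
    (A : E → E → ℝ≥0∞)
    (hA : ∀ x y, A x y = ENNReal.ofReal (Real.exp (-β x) * p x y))
    (q : E → E → ℝ) (hq_meas : Measurable (Function.uncurry q))
    (hq_nonneg : ∀ x ∈ S, ∀ y ∈ K, 0 ≤ q x y)
    (hLyap : ∀ x ∈ S, ∀ y ∈ K,
      (∫⁻ z in S, A x z * ENNReal.ofReal (q z y) ∂lam) + A x y
        ≤ ENNReal.ofReal (q x y)) :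
    ∀ x ∈ S, ∀ y ∈ K, ∑' n, tabooIter lam S A n x y ≤ ENNReal.ofReal (q x y) := by
  have hA_meas : Measurable (Function.uncurry A) := by
    have hA_eq : Function.uncurry A = fun w : E × E =>
        ENNReal.ofReal (Real.exp (-β w.1) * p w.1 w.2) := funext fun w => hA w.1 w.2
    rw [hA_eq]
    exact ((hβ.comp measurable_fst).neg.exp.mul hp_meas).ennreal_ofReal
  intro x hx y hy
  exact tsum_tabooIter_le lam hS hA_meas y (Q := fun z => ENNReal.ofReal (q z y))
    (fun z hz => hLyap z hz y hy) hx
end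

section
/- Let (E,λ) be a measure space with λ σ-finite, let S and K be disjoint measurable subsets of E, let β : E → ℝ and p : E × E → [0,∞) be measurable, write A(x,y) = e^{−β(x)} p(x,y), and define the taboo iterates on S by a₀(x,y) = A(x,y), a_{n+1}(x,y) = ∫_S A(x,z) aₙ(z,y) λ(dz). Suppose: (i) there exists measurable q : S × K → [0,∞) with ∫_S A(x,z) q(z,y) λ(dz) ≤ q(x,y) − A(x,y) for all x ∈ S, y ∈ K; and (ii) there exist c < 1 and a measurable η : K → (0,∞) with ∫_K η dλ = 1 such that A(x,y) + ∫_S A(x,z) q(z,y) λ(dz) ≤ c η(y) for all x, y ∈ K. Define, for x, y ∈ K, the discounted first-return density h̃(x,y) = A(x,y) + Σ_{n=0}^∞ ∫_S A(x,z) aₙ(z,y) λ(dz). Then h̃(x,y) ≤ c η(y) for all x, y ∈ K, and consequently ∫_K η(x) h̃(x,y) λ(dx) ≤ c η(y) for all y ∈ K, i.e., the kernel H̃(x,dy) = h̃(x,y) λ(dy) on K satisfies νH̃ ≤ c ν for ν(dy) = η(y) λ(dy). -/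
open MeasureTheory ProbabilityTheory ENNReal

theorem measurable_uncurry_tabooIter {E : Type*} [MeasurableSpace E] {lam : Measure E}
    [SFinite lam] (S : Set E) {A : E → E → ℝ≥0∞} (hA : Measurable (Function.uncurry A)) (n : ℕ) :
    Measurable (Function.uncurry (tabooIter lam S A n)) := by
  induction n with
  | zero => exact hA
  | succ n ih =>
    have hint : Measurable fun r : (E × E) × E => A r.1.1 r.2 * tabooIter lam S A n r.2 r.1.2 :=
      (hA.comp (measurable_fst.fst.prodMk measurable_snd)).mul
        (ih.comp (measurable_snd.prodMk measurable_fst.snd))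
    exact hint.lintegral_prod_right' (ν := lam.restrict S)

theorem sum_lintegral_mul_tabooIter {E : Type*} [MeasurableSpace E] {lam : Measure E}
    [SFinite lam] (S : Set E) {A : E → E → ℝ≥0∞} (hA : Measurable (Function.uncurry A))
    (N : ℕ) (x y : E) :
    ∑ n ∈ Finset.range N, ∫⁻ z in S, A x z * tabooIter lam S A n z y ∂lam
      = ∫⁻ z in S, A x z * ∑ n ∈ Finset.range N, tabooIter lam S A n z y ∂lam := by
  simp_rw [Finset.mul_sum]
  refine (lintegral_finsetSum _ fun n _ => ?_).symm
  exact hA.of_uncurry_left.mul (measurable_uncurry_tabooIter S hA n).of_uncurry_right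

/-- A Lyapunov function dominates every partial sum of the taboo iterates. -/
theorem sum_tabooIter_le {E : Type*} [MeasurableSpace E] {lam : Measure E}
    [SFinite lam] {S : Set E} (hS : MeasurableSet S) {A : E → E → ℝ≥0∞}
    (hA : Measurable (Function.uncurry A)) {Q : E → ℝ≥0∞} {y : E}
    (hQ : ∀ x ∈ S, (∫⁻ z in S, A x z * Q z ∂lam) + A x y ≤ Q x) (N : ℕ) :
    ∀ x ∈ S, ∑ n ∈ Finset.range N, tabooIter lam S A n x y ≤ Q x := by
  induction N with
  | zero => simp
  | succ N ih =>
    intro x hx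
    rw [Finset.sum_range_succ']
    refine le_trans (add_le_add_left ?_ _) (hQ x hx)
    exact (sum_lintegral_mul_tabooIter S hA N x y).trans_le
      (setLIntegral_mono' hS fun z hz => mul_le_mul_right (ih z hz) _)

/-- A Lyapunov function bounds the total discounted excursion density through `S`. -/
theorem tsum_lintegral_mul_tabooIter_le {E : Type*} [MeasurableSpace E] {lam : Measure E}
    [SFinite lam] {S : Set E} (hS : MeasurableSet S) {A : E → E → ℝ≥0∞}
    (hA : Measurable (Function.uncurry A)) {Q : E → ℝ≥0∞} {y : E}
    (hQ : ∀ x ∈ S, (∫⁻ z in S, A x z * Q z ∂lam) + A x y ≤ Q x) (x : E) :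
    ∑' n, ∫⁻ z in S, A x z * tabooIter lam S A n z y ∂lam ≤ ∫⁻ z in S, A x z * Q z ∂lam :=
  ENNReal.tsum_le_of_sum_range_le fun N =>
    (sum_lintegral_mul_tabooIter S hA N x y).trans_le
      (setLIntegral_mono' hS fun z hz => mul_le_mul_right (sum_tabooIter_le hS hA hQ N z hz) _)

/-- Lyapunov-based sufficient condition for the killed-kernel domination: if
`∫_S A(x,z) q(z,y) λ(dz) ≤ q(x,y) − A(x,y)` on `S × K` and
`A(x,y) + ∫_S A(x,z) q(z,y) λ(dz) ≤ c η(y)` for all `x,y ∈ K`, where `η > 0`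
on `K` with `∫_K η dλ = 1` and `c < 1`, then the discounted first-return
density `h̃(x,y) = A(x,y) + Σₙ ∫_S A(x,z) aₙ(z,y) λ(dz)` satisfies
`h̃(x,y) ≤ c η(y)` on `K × K` and hence
`∫_K η(x) h̃(x,y) λ(dx) ≤ c η(y)` on `K`, i.e. `νH̃ ≤ cν` for
`ν(dy) = η(y) λ(dy)`. -/
theorem stmt11 {E : Type*} [MeasurableSpace E]
    (lam : Measure E) [SigmaFinite lam]
    (S K : Set E) (hS : MeasurableSet S) (hK : MeasurableSet K)
    (hdisj : Disjoint S K)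
    (β : E → ℝ) (hβ : Measurable β)
    (p : E → E → ℝ) (hp_meas : Measurable (Function.uncurry p))
    (hp_nonneg : ∀ x y, 0 ≤ p x y)
    (A : E → E → ℝ≥0∞)
    (hA : ∀ x y, A x y = ENNReal.ofReal (Real.exp (-β x) * p x y))
    (q : E → E → ℝ) (hq_meas : Measurable (Function.uncurry q))
    (hq_nonneg : ∀ x ∈ S, ∀ y ∈ K, 0 ≤ q x y)
    (hLyap : ∀ x ∈ S, ∀ y ∈ K,
      (∫⁻ z in S, A x z * ENNReal.ofReal (q z y) ∂lam) + A x y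
        ≤ ENNReal.ofReal (q x y))
    (c : ℝ) (hc : c < 1)
    (η : E → ℝ) (hη_meas : Measurable η) (hη_pos : ∀ x ∈ K, 0 < η x)
    (hη_int : ∫ x in K, η x ∂lam = 1)
    (hcη : ∀ x ∈ K, ∀ y ∈ K,
      A x y + (∫⁻ z in S, A x z * ENNReal.ofReal (q z y) ∂lam)
        ≤ ENNReal.ofReal (c * η y))
    (ht : E → E → ℝ≥0∞)
    (hht : ∀ x y, ht x y
      = A x y + ∑' n, ∫⁻ z in S, A x z * tabooIter lam S A n z y ∂lam) :
    (∀ x ∈ K, ∀ y ∈ K, ht x y ≤ ENNReal.ofReal (c * η y)) ∧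
    (∀ y ∈ K, (∫⁻ x in K, ENNReal.ofReal (η x) * ht x y ∂lam)
        ≤ ENNReal.ofReal (c * η y)) := by
  have hA_meas : Measurable (Function.uncurry A) := by
    have hA_eq : Function.uncurry A
        = fun r => ENNReal.ofReal (Real.exp (-β r.1) * Function.uncurry p r) :=
      funext fun r => hA r.1 r.2
    rw [hA_eq]
    fun_prop
  have hbound : ∀ x ∈ K, ∀ y ∈ K, ht x y ≤ ENNReal.ofReal (c * η y) := by
    intro x hx y hy
    rw [hht]
    refine le_trans (add_le_add_right ?_ _) (hcη x hx y hy)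
    exact tsum_lintegral_mul_tabooIter_le hS hA_meas (fun z hz => hLyap z hz y hy) x
  refine ⟨hbound, fun y hy => ?_⟩
  have hη_integrable : IntegrableOn η K lam :=
    Integrable.of_integral_ne_zero (by simp [hη_int])
  have hη_mass : ∫⁻ x in K, ENNReal.ofReal (η x) ∂lam = 1 := by
    rw [← ofReal_integral_eq_lintegral_ofReal hη_integrable, hη_int, ENNReal.ofReal_one]
    filter_upwards [ae_restrict_mem hK] with x hx using (hη_pos x hx).le
  calc ∫⁻ x in K, ENNReal.ofReal (η x) * ht x y ∂lam
      ≤ ∫⁻ x in K, ENNReal.ofReal (η x) * ENNReal.ofReal (c * η y) ∂lam :=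
        setLIntegral_mono' hK fun x hx => mul_le_mul_right (hbound x hx y hy) _
    _ = ENNReal.ofReal (c * η y) := by
        rw [lintegral_mul_const _ hη_meas.ennreal_ofReal, hη_mass, one_mul]
end
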